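/- Consider regular 2^{6-2} designs with 16 runs, represented by 6 nonzero, pairwise distinct vectors v_1, …, v_6 spanning (ZMod 2)^4 (the nonzero-and-distinct condition is equivalent to resolution at least III). Call two such designs isomorphic if there exist g ∈ GL(4, ZMod 2) and a permutation σ of {1, …, 6} with g(v_i) = v'_{σ(i)} for all i. Then there are exactly 4 isomorphism classes of such designs. -/

import Mathlib

/-- A regular two-level fractional factorial design with `2^k` runs and `n` factors of
resolution at least III: `n` nonzero, pairwise distinct vectors spanning `(ZMod 2)^k`. -/
def TwoLevelDesign (n k : ℕ) : Type :=
  {v : Fin n → Fin k → ZMod 2 //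
    (∀ i, v i ≠ 0) ∧ Function.Injective v ∧
      Submodule.span (ZMod 2) (Set.range v) = ⊤}

/-- Isomorphism of regular two-level designs: a linear automorphism `g` of `(ZMod 2)^k`
together with a permutation `σ` of the factors with `g (v i) = v' (σ i)` for all `i`. -/
def TwoLevelDesignIso {n k : ℕ} (D D' : TwoLevelDesign n k) : Prop :=
  ∃ (g : (Fin k → ZMod 2) ≃ₗ[ZMod 2] (Fin k → ZMod 2)) (σ : Equiv.Perm (Fin n)),
    ∀ i, g (D.1 i) = D'.1 (σ i)

namespace TwoLevelDesign

variable {n k : ℕ}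

theorem eq_zero_or_one_zmod_two (s : ZMod 2) : s = 0 ∨ s = 1 := by
  decide +revert

theorem add_eq_zero_zmod_two {x y : Fin n → ZMod 2} : x + y = 0 ↔ x = y := by
  rw [← ZModModule.sub_eq_add, sub_eq_zero]

/-- The linear map sending coefficients `c` to `∑ i, c i • v i`; its kernel consists of the
words of the defining contrast subgroup. -/
noncomputable def relationMap (D : TwoLevelDesign n k) :
    (Fin n → ZMod 2) →ₗ[ZMod 2] (Fin k → ZMod 2) :=
  Fintype.linearCombination (ZMod 2) D.1

theorem relationMap_apply (D : TwoLevelDesign n k) (c : Fin n → ZMod 2) :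
    D.relationMap c = ∑ i, c i • D.1 i := rfl

theorem relationMap_surjective (D : TwoLevelDesign n k) :
    Function.Surjective D.relationMap := by
  rw [← LinearMap.range_eq_top, relationMap, Fintype.range_linearCombination]
  exact D.2.2.2

/-- The words of the defining contrast subgroup, including the empty word. -/
def words (D : TwoLevelDesign n k) : Finset (Fin n → ZMod 2) :=
  Finset.univ.filter fun c => ∑ i, c i • D.1 i = 0

theorem mem_words {D : TwoLevelDesign n k} {c : Fin n → ZMod 2} :
    c ∈ D.words ↔ D.relationMap c = 0 := by
  simp [words, relationMap_apply]

/-- The multiset of lengths of the words of the defining contrast subgroup. -/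
def wordLengths (D : TwoLevelDesign n k) : Multiset ℕ :=
  D.words.val.map hammingNorm

theorem hammingNorm_comp_perm (c : Fin n → ZMod 2) (σ : Equiv.Perm (Fin n)) :
    hammingNorm (c ∘ σ) = hammingNorm c := by
  simp only [hammingNorm, Finset.card_filter, Function.comp_apply]
  exact Equiv.sum_comp σ fun i => if c i ≠ 0 then 1 else 0

theorem wordLengths_eq_of_iso {D D' : TwoLevelDesign n k} (h : TwoLevelDesignIso D D') :
    D.wordLengths = D'.wordLengths := by
  obtain ⟨g, σ, h⟩ := h
  have key (c : Fin n → ZMod 2) : g (D.relationMap (c ∘ σ)) = D'.relationMap c := by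
    simp only [relationMap_apply, map_sum, map_smul, h, Function.comp_apply]
    exact Equiv.sum_comp σ fun i => c i • D'.1 i
  have hw : D.words = D'.words.map (σ.symm.arrowCongr (Equiv.refl (ZMod 2))).toEmbedding := by
    ext c
    rw [Finset.mem_map_equiv, mem_words, mem_words, ← key, map_eq_zero_iff g g.injective]
    congr! 2
    ext i
    simp
  rw [wordLengths, hw, Finset.map_val, Multiset.map_map, wordLengths]
  exact Multiset.map_congr rfl fun c _ => hammingNorm_comp_perm c σ

theorem iso_of_words {D D' : TwoLevelDesign n k} (σ : Equiv.Perm (Fin n))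
    (h : ∀ c, c ∘ σ ∈ D.words ↔ c ∈ D'.words) : TwoLevelDesignIso D D' := by
  let p := LinearMap.funLeft (ZMod 2) (ZMod 2) σ.symm
  have hp : Function.Surjective (D'.relationMap ∘ₗ p) :=
    D'.relationMap_surjective.comp (LinearMap.funLeft_surjective_of_injective _ _ _
      σ.symm.injective)
  have hker : LinearMap.ker D.relationMap = LinearMap.ker (D'.relationMap ∘ₗ p) := by
    ext c
    have := h (c ∘ σ.symm)
    rw [mem_words, mem_words, Function.comp_assoc, Equiv.symm_comp_self, Function.comp_id] at this
    exact this
  let e := D.relationMap.quotKerEquivOfSurjective D.relationMap_surjective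
  let e' := (D'.relationMap ∘ₗ p).quotKerEquivOfSurjective hp
  refine ⟨e.symm.trans ((Submodule.quotEquivOfEq _ _ hker).trans e'), σ, fun i => ?_⟩
  have h₁ : e (Submodule.Quotient.mk (Pi.single i 1)) = D.1 i := by
    change D.relationMap (Pi.single i 1) = _
    simp [relationMap]
  have h₂ : p (Pi.single i 1) = Pi.single (σ i) 1 := by
    ext j
    simp [p, LinearMap.funLeft_apply, Pi.single_apply, Equiv.symm_apply_eq]
  rw [← h₁]
  simp only [LinearEquiv.trans_apply, LinearEquiv.symm_apply_apply]
  change D'.relationMap (p (Pi.single i 1)) = _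
  rw [h₂]
  simp [relationMap]

theorem exists_words_eq (D : TwoLevelDesign (k + 2) k) :
    ∃ x y, x ≠ 0 ∧ y ≠ 0 ∧ x ≠ y ∧ D.words = {0, x, y, x + y} := by
  have hr : Module.finrank (ZMod 2) (LinearMap.ker D.relationMap) = 2 := by
    have := D.relationMap.finrank_range_add_finrank_ker
    rw [LinearMap.range_eq_top.2 D.relationMap_surjective] at this
    simp at this
    omega
  let b := Module.finBasisOfFinrankEq _ _ hr
  refine ⟨b 0, b 1, ?_, ?_, ?_, ?_⟩
  · exact fun h => b.ne_zero 0 (Subtype.ext h)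
  · exact fun h => b.ne_zero 1 (Subtype.ext h)
  · exact fun h => absurd (b.injective (Subtype.ext h)) (by decide)
  · ext c
    simp only [Finset.mem_insert, Finset.mem_singleton]
    constructor
    · intro hc
      have h := b.sum_repr ⟨c, mem_words.1 hc⟩
      rw [Fin.sum_univ_two] at h
      have h := congrArg Subtype.val h
      simp only [Submodule.coe_add, Submodule.coe_smul] at h
      rcases eq_zero_or_one_zmod_two (b.repr ⟨c, mem_words.1 hc⟩ 0) with h0 | h0 <;>
      rcases eq_zero_or_one_zmod_two (b.repr ⟨c, mem_words.1 hc⟩ 1) with h1 | h1 <;>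
      rw [h0, h1] at h <;> simp [← h]
    · rw [mem_words]
      rintro (rfl | rfl | rfl | rfl)
      · simp
      · exact (b 0).2
      · exact (b 1).2
      · exact (b 0 + b 1).2

theorem add_add_cancel_zmod_two (x y : Fin n → ZMod 2) : x + (x + y) = y := by
  rw [← add_assoc, ZModModule.add_self, zero_add]

theorem exists_words_eq_sorted (D : TwoLevelDesign (k + 2) k) :
    ∃ x y, x ≠ 0 ∧ y ≠ 0 ∧ x ≠ y ∧ D.words = {0, x, y, x + y} ∧
      hammingNorm x ≤ hammingNorm y ∧ hammingNorm y ≤ hammingNorm (x + y) := by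
  obtain ⟨x, y, hx, hy, hxy, hw⟩ := D.exists_words_eq
  have hz : x + y ≠ 0 := fun h => hxy (add_eq_zero_zmod_two.1 h)
  have hxz : x ≠ x + y := fun h => hy (by simpa using h)
  have hyz : y ≠ x + y := fun h => hx (by simpa using h)
  have hxz' := add_add_cancel_zmod_two x y
  have hyz' : y + (x + y) = x := by rw [add_comm x, add_add_cancel_zmod_two]
  rcases le_total (hammingNorm x) (hammingNorm y) with h₁ | h₁
  · rcases le_total (hammingNorm y) (hammingNorm (x + y)) with h₂ | h₂
    · exact ⟨x, y, hx, hy, hxy, hw, h₁, h₂⟩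
    rcases le_total (hammingNorm x) (hammingNorm (x + y)) with h₃ | h₃
    · refine ⟨x, x + y, hx, hz, hxz, ?_, h₃, by rwa [hxz']⟩
      rw [hw, hxz', Finset.pair_comm y]
    · refine ⟨x + y, x, hz, hx, hxz.symm, ?_, h₃, by rwa [add_comm (x + y), hxz']⟩
      rw [hw, add_comm (x + y) x, hxz', Finset.insert_comm (x + y), Finset.pair_comm y]
  · rcases le_total (hammingNorm x) (hammingNorm (x + y)) with h₂ | h₂
    · refine ⟨y, x, hy, hx, hxy.symm, ?_, h₁, by rwa [add_comm y]⟩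
      rw [hw, add_comm y, Finset.insert_comm x]
    rcases le_total (hammingNorm y) (hammingNorm (x + y)) with h₃ | h₃
    · refine ⟨y, x + y, hy, hz, hyz, ?_, h₃, by rwa [hyz']⟩
      rw [hw, hyz', Finset.insert_comm x, Finset.pair_comm x]
    · refine ⟨x + y, y, hz, hy, hyz.symm, ?_, h₃, by rwa [add_comm (x + y), hyz']⟩
      rw [hw, add_comm (x + y) y, hyz', Finset.insert_comm x, Finset.pair_comm x,
        Finset.insert_comm y]

theorem wordLengths_eq {D : TwoLevelDesign n k} {x y : Fin n → ZMod 2} (hx : x ≠ 0)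
    (hy : y ≠ 0) (hxy : x ≠ y) (hw : D.words = {0, x, y, x + y}) :
    D.wordLengths = {0, hammingNorm x, hammingNorm y, hammingNorm (x + y)} := by
  have hz : x + y ≠ 0 := fun h => hxy (add_eq_zero_zmod_two.1 h)
  rw [wordLengths, hw, Finset.insert_val_of_notMem, Finset.insert_val_of_notMem,
    Finset.insert_val_of_notMem]
  · simp
  · simpa using hx
  · simp [hxy, hy]
  · simp [hx.symm, hy.symm, hz.symm]

/-- The number of coordinates at which a pair of words takes each pair of values is determined
by the lengths of the two words and of their sum. -/
theorem card_pair_eq (x y : Fin n → ZMod 2) :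
    let N (s : ZMod 2 × ZMod 2) := Fintype.card {i // (x i, y i) = s}
    N (1, 0) + N (1, 1) = hammingNorm x ∧ N (0, 1) + N (1, 1) = hammingNorm y ∧
      N (1, 0) + N (0, 1) = hammingNorm (x + y) ∧
      N (0, 0) + N (1, 0) + N (0, 1) + N (1, 1) = n := by
  have hn : n = ∑ _i : Fin n, 1 := by simp
  simp only [Fintype.card_subtype, hammingNorm, Finset.card_filter, ← Finset.sum_add_distrib,
    Pi.add_apply]
  refine ⟨?_, ?_, ?_, ?_⟩
  on_goal 4 => conv_rhs => rw [hn]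
  all_goals
    refine Finset.sum_congr rfl fun i _ => ?_
    rcases eq_zero_or_one_zmod_two (x i) with h | h <;>
    rcases eq_zero_or_one_zmod_two (y i) with h' | h' <;>
    simp [h, h', CharTwo.add_self_eq_zero]

theorem exists_perm_of_hammingNorm_eq {x y x' y' : Fin n → ZMod 2}
    (hx : hammingNorm x = hammingNorm x') (hy : hammingNorm y = hammingNorm y')
    (hz : hammingNorm (x + y) = hammingNorm (x' + y')) :
    ∃ σ : Equiv.Perm (Fin n), x' ∘ σ = x ∧ y' ∘ σ = y := by
  obtain ⟨h₁, h₂, h₃, h₄⟩ := card_pair_eq x y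
  obtain ⟨h₁', h₂', h₃', h₄'⟩ := card_pair_eq x' y'
  have hcard : ∀ s : ZMod 2 × ZMod 2,
      Fintype.card {i // (x i, y i) = s} = Fintype.card {i // (x' i, y' i) = s} := by
    have hs : ∀ s : ZMod 2 × ZMod 2, s = (0, 0) ∨ s = (1, 0) ∨ s = (0, 1) ∨ s = (1, 1) := by
      decide
    dsimp only at h₁ h₂ h₃ h₄ h₁' h₂' h₃' h₄'
    intro s
    rcases hs s with rfl | rfl | rfl | rfl <;> omega
  let σ := Equiv.ofFiberEquiv (f := fun i => (x i, y i)) (g := fun i => (x' i, y' i))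
    fun s => Fintype.equivOfCardEq (hcard s)
  have h (i : Fin n) : (x' (σ i), y' (σ i)) = (x i, y i) := Equiv.ofFiberEquiv_map
    (f := fun i => (x i, y i)) (g := fun i => (x' i, y' i)) _ i
  exact ⟨σ, funext fun i => congrArg Prod.fst (h i), funext fun i => congrArg Prod.snd (h i)⟩

theorem iso_of_wordLengths_eq {D D' : TwoLevelDesign (k + 2) k}
    (h : D.wordLengths = D'.wordLengths) : TwoLevelDesignIso D D' := by
  obtain ⟨x, y, hx, hy, hxy, hw, hle₁, hle₂⟩ := D.exists_words_eq_sorted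
  obtain ⟨x', y', hx', hy', hxy', hw', hle₁', hle₂'⟩ := D'.exists_words_eq_sorted
  rw [wordLengths_eq hx hy hxy hw, wordLengths_eq hx' hy' hxy' hw'] at h
  have hperm : [hammingNorm x, hammingNorm y, hammingNorm (x + y)].Perm
      [hammingNorm x', hammingNorm y', hammingNorm (x' + y')] :=
    Multiset.coe_eq_coe.1 ((Multiset.cons_inj_right 0).1 h)
  have heq := hperm.eq_of_pairwise (le := (· ≤ ·)) (fun _ _ _ _ => le_antisymm)
    (by simp; omega) (by simp; omega)
  simp only [List.cons.injEq, and_true] at heq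
  obtain ⟨σ, rfl, rfl⟩ := exists_perm_of_hammingNorm_eq heq.1 heq.2.1 heq.2.2
  have hinj : Function.Injective fun c : Fin (k + 2) → ZMod 2 => c ∘ σ :=
    σ.surjective.injective_comp_right
  refine iso_of_words σ fun c => ?_
  have hzero : c ∘ σ = 0 ↔ c = 0 := hinj.eq_iff (b := 0)
  have hadd : c ∘ σ = x' ∘ σ + y' ∘ σ ↔ c = x' + y' := hinj.eq_iff (b := x' + y')
  have h₁ : c ∘ σ = x' ∘ σ ↔ c = x' := hinj.eq_iff
  have h₂ : c ∘ σ = y' ∘ σ ↔ c = y' := hinj.eq_iff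
  simp only [hw, hw', Finset.mem_insert, Finset.mem_singleton, hzero, hadd, h₁, h₂]

theorem three_le_hammingNorm {D : TwoLevelDesign n k} {c : Fin n → ZMod 2} (hc : c ∈ D.words)
    (h0 : c ≠ 0) : 3 ≤ hammingNorm c := by
  have hsum : ∑ i with c i ≠ 0, D.1 i = 0 := by
    refine Eq.trans ?_ (mem_words.1 hc)
    rw [relationMap_apply, Finset.sum_filter]
    refine Finset.sum_congr rfl fun i _ => ?_
    rcases eq_zero_or_one_zmod_two (c i) with h | h <;> simp [h]
  by_contra! hlt
  have hpos := hammingNorm_pos_iff.2 h0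
  obtain h | h : hammingNorm c = 1 ∨ hammingNorm c = 2 := by omega
  · obtain ⟨i, hi⟩ := Finset.card_eq_one.1 h
    rw [hi, Finset.sum_singleton] at hsum
    exact D.2.1 i hsum
  · obtain ⟨i, j, hij, hs⟩ := Finset.card_eq_two.1 h
    rw [hs, Finset.sum_pair hij] at hsum
    exact hij (D.2.2.1 (add_eq_zero_zmod_two.1 hsum))

/-- The possible word lengths of a `2^{6-2}` design of resolution at least III. -/
def sixTwoWordLengths : Fin 4 → Multiset ℕ :=
  ![{0, 3, 3, 4}, {0, 3, 3, 6}, {0, 3, 4, 5}, {0, 4, 4, 4}]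

theorem exists_wordLengths_eq (D : TwoLevelDesign 6 4) :
    ∃ j, D.wordLengths = sixTwoWordLengths j := by
  obtain ⟨x, y, hx, hy, hxy, hw, hle₁, hle₂⟩ := D.exists_words_eq_sorted
  have h3 := three_le_hammingNorm (D := D) (c := x) (by simp [hw]) hx
  obtain ⟨h₁, h₂, h₃, h₄⟩ := card_pair_eq x y
  rw [wordLengths_eq hx hy hxy hw]
  obtain ⟨ha, hb, hc⟩ | ⟨ha, hb, hc⟩ | ⟨ha, hb, hc⟩ | ⟨ha, hb, hc⟩ :
      (hammingNorm x = 3 ∧ hammingNorm y = 3 ∧ hammingNorm (x + y) = 4) ∨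
      (hammingNorm x = 3 ∧ hammingNorm y = 3 ∧ hammingNorm (x + y) = 6) ∨
      (hammingNorm x = 3 ∧ hammingNorm y = 4 ∧ hammingNorm (x + y) = 5) ∨
      (hammingNorm x = 4 ∧ hammingNorm y = 4 ∧ hammingNorm (x + y) = 4) := by omega
  all_goals rw [ha, hb, hc]
  exacts [⟨0, rfl⟩, ⟨1, rfl⟩, ⟨2, rfl⟩, ⟨3, rfl⟩]

/-- The factors of the design with four basic factors and two further generators `a`, `b`. -/
def generatedFactors (a b : Fin 4 → ZMod 2) : Fin 6 → Fin 4 → ZMod 2 :=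
  ![Pi.single 0 1, Pi.single 1 1, Pi.single 2 1, Pi.single 3 1, a, b]

/-- The design with four basic factors and two further generators `a`, `b`. -/
def ofGenerators (a b : Fin 4 → ZMod 2) (h0 : ∀ i, generatedFactors a b i ≠ 0)
    (hinj : Function.Injective (generatedFactors a b)) : TwoLevelDesign 6 4 :=
  ⟨generatedFactors a b, h0, hinj, by
    rw [eq_top_iff, ← (Pi.basisFun (ZMod 2) (Fin 4)).span_eq, Submodule.span_le]
    rintro _ ⟨i, rfl⟩
    refine Submodule.subset_span ⟨i.castLE (by decide), ?_⟩
    fin_cases i <;> simp [generatedFactors]⟩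

/-- Representatives of the isomorphism classes of `2^{6-2}` designs. -/
def sixTwoRepresentative : Fin 4 → TwoLevelDesign 6 4 :=
  ![ofGenerators ![1, 1, 0, 0] ![1, 0, 1, 0] (by decide) (by decide),
    ofGenerators ![1, 1, 0, 0] ![0, 0, 1, 1] (by decide) (by decide),
    ofGenerators ![1, 1, 0, 0] ![1, 0, 1, 1] (by decide) (by decide),
    ofGenerators ![1, 1, 1, 0] ![1, 1, 0, 1] (by decide) (by decide)]

theorem wordLengths_sixTwoRepresentative (j : Fin 4) :
    (sixTwoRepresentative j).wordLengths = sixTwoWordLengths j := by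
  revert j
  decide +kernel

end TwoLevelDesign

open TwoLevelDesign in
/-- There are exactly 4 isomorphism classes of regular `2^{6-2}` designs with 16 runs of
resolution at least III: there are 4 designs such that every design is isomorphic to
exactly one of them. -/
theorem four_isoClasses_of_two_pow_six_sub_two :
    ∃ reps : Fin 4 → TwoLevelDesign 6 4,
      ∀ D : TwoLevelDesign 6 4, ∃! j : Fin 4, TwoLevelDesignIso D (reps j) := by
  have hinj : Function.Injective sixTwoWordLengths := by decide
  refine ⟨sixTwoRepresentative, fun D => ?_⟩
  obtain ⟨j, hj⟩ := D.exists_wordLengths_eq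
  refine ⟨j, iso_of_wordLengths_eq (hj.trans (wordLengths_sixTwoRepresentative j).symm), ?_⟩
  intro i hi
  apply hinj
  rw [← wordLengths_sixTwoRepresentative i, ← wordLengths_eq_of_iso hi, hj]
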